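/- arXiv:1604.02187 — 2 statements merged into one kernel-verified Lean document; each statement's English description precedes it below -/
import Mathlib

section
/- Unisolvency of the first element: let T be a triangle, b = λ₁λ₂λ₃ the cubic bubble, and W(T) = [P₂(T)]² ⊕ b·P₂*(T) where P₂*(T) = {v ∈ [P₂(T)]² : (v·n)|_e ∈ P₁(e) for every edge e of T}. Then dim W(T) = 21, and any w ∈ W(T) is uniquely determined by: the values of w at the 3 vertices and 3 edge midpoints (12 values), the moments ∫_e ∂_n(w·t) dτ for each edge (3 values), and the moments ∫_e ∂_n(w·n) τ^k dτ for k = 0,1 and each edge (6 values). -/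
open MeasureTheory

noncomputable section

abbrev V2 := EuclideanSpace ℝ (Fin 2)

/-- Euclidean dot product on `ℝ²`. -/
def dot (u v : V2) : ℝ := ∑ j, u j * v j

/-- `f : ℝ² → ℝ` is a polynomial of total degree at most `k`. -/
def PolyDeg (k : ℕ) (f : V2 → ℝ) : Prop :=
  ∃ p : MvPolynomial (Fin 2) ℝ, p.totalDegree ≤ k ∧
    ∀ x, f x = MvPolynomial.eval (fun i => x i) p

/-- a vector field all of whose components are polynomials of degree at most `k`,
i.e. an element of `[P_k]²`. -/
def PolyVecDeg (k : ℕ) (w : V2 → V2) : Prop := ∀ j, PolyDeg k (fun x => w x j)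

/-- the divergence of a vector field on `ℝ²` -/
def divP (w : V2 → V2) (x : V2) : ℝ :=
  ∑ j, fderiv ℝ (fun y => w y j) x (EuclideanSpace.single j 1)

/-- A nondegenerate triangle `T ⊆ ℝ²` with vertices `A 0, A 1, A 2`, barycentric
coordinate functions `lam i` and unit outward normals `nv i` to the edge `e_i`
opposite the vertex `A i` (the edge from `A (i+1)` to `A (i+2)`). -/
structure TriangleData where
  A : Fin 3 → V2
  lam : Fin 3 → V2 → ℝ
  nv : Fin 3 → V2
  indep : AffineIndependent ℝ A
  lam_poly : ∀ i, PolyDeg 1 (lam i)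
  lam_vertex : ∀ i j, lam i (A j) = if i = j then (1 : ℝ) else 0
  lam_sum : ∀ x, ∑ i, lam i x = 1
  nv_unit : ∀ i, ‖nv i‖ = 1
  nv_orth : ∀ i, dot (nv i) (A (i + 2) - A (i + 1)) = 0
  nv_outward : ∀ i, dot (nv i) (A i - A (i + 1)) < 0

namespace TriangleData

variable (T : TriangleData)

/-- the cubic bubble `b = λ₁λ₂λ₃` -/
def bub (x : V2) : ℝ := ∏ i, T.lam i x

/-- affine parametrization of the edge `e_i` (from `A (i+1)` at `t = 0` to
`A (i+2)` at `t = 1`) -/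
def Ept (i : Fin 3) (t : ℝ) : V2 := T.A (i + 1) + t • (T.A (i + 2) - T.A (i + 1))

/-- the unit tangent of the edge `e_i` -/
def tv (i : Fin 3) : V2 := ‖T.A (i + 2) - T.A (i + 1)‖⁻¹ • (T.A (i + 2) - T.A (i + 1))

/-- the midpoint of the edge `e_i` -/
def mid (i : Fin 3) : V2 := midpoint ℝ (T.A (i + 1)) (T.A (i + 2))

/-- the normal derivative `∂_n f` along edge `e_i`, at edge parameter `t` -/
def nder (f : V2 → ℝ) (i : Fin 3) (t : ℝ) : ℝ := fderiv ℝ f (T.Ept i t) (T.nv i)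

/-- membership in `P₂*(T) = {v ∈ [P₂(T)]² : (v·n)|_e ∈ P₁(e) for every edge e}` -/
def memP2star (p : V2 → V2) : Prop :=
  PolyVecDeg 2 p ∧ ∀ i, ∃ a c : ℝ, ∀ t : ℝ, dot (p (T.Ept i t)) (T.nv i) = a * t + c

/-- membership in `W(T) = [P₂(T)]² ⊕ b·P₂*(T)` (the first element) -/
def memW1 (w : V2 → V2) : Prop :=
  ∃ q p, PolyVecDeg 2 q ∧ T.memP2star p ∧ ∀ x, w x = q x + T.bub x • p x

/-- membership in
`P₃*(T) = {w ∈ [P₃(T)]² : ∇·w ∈ P₀(T), (w·n)|_e ∈ P₁(e) for every edge e}` -/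
def memP3star (p : V2 → V2) : Prop :=
  PolyVecDeg 3 p ∧ (∃ c : ℝ, ∀ x, divP p x = c) ∧
    ∀ i, ∃ a c : ℝ, ∀ t : ℝ, dot (p (T.Ept i t)) (T.nv i) = a * t + c

/-- membership in `W(T) = [P₂(T)]² ⊕ b·P₃*(T)` (the second element) -/
def memW2 (w : V2 → V2) : Prop :=
  ∃ q p, PolyVecDeg 2 q ∧ T.memP3star p ∧ ∀ x, w x = q x + T.bub x • p x

/-- vanishing of the 21 degrees of freedom: the values of `w` at the three vertices and
three edge midpoints, the moments `∫_e ∂_n(w·t) dτ`, and the moments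
`∫_e ∂_n(w·n) τ^k dτ`, `k = 0,1`, over each edge. -/
def dofsVanish (w : V2 → V2) : Prop :=
  (∀ i, w (T.A i) = 0) ∧ (∀ i, w (T.mid i) = 0) ∧
    (∀ i, (∫ t in (0 : ℝ)..1, T.nder (fun x => dot (w x) (T.tv i)) i t) = 0) ∧
    (∀ i, ∀ k : Fin 2,
      (∫ t in (0 : ℝ)..1, T.nder (fun x => dot (w x) (T.nv i)) i t * t ^ (k : ℕ)) = 0)

end TriangleData

namespace TriangleData

/-! ### General facts -/

lemma aux_sum3 {M : Type*} [AddCommMonoid M] (f : Fin 3 → M) (i : Fin 3) :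
    ∑ j, f j = f i + f (i + 1) + f (i + 2) := by
  have := Equiv.sum_comp (Equiv.addLeft i) f
  rw [← this, Fin.sum_univ_three]
  simp

lemma aux_prod3 {M : Type*} [CommMonoid M] (f : Fin 3 → M) (i : Fin 3) :
    ∏ j, f j = f i * (f (i + 1) * f (i + 2)) := by
  have := Equiv.prod_comp (Equiv.addLeft i) f
  rw [← this, Fin.prod_univ_three]
  simp [mul_assoc]

lemma f11 (i : Fin 3) : i + 1 + 1 = i + 2 := by revert i; decide
lemma f12 (i : Fin 3) : i + 1 + 2 = i := by revert i; decide
lemma f21 (i : Fin 3) : i + 2 + 1 = i := by revert i; decide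
lemma f22 (i : Fin 3) : i + 2 + 2 = i + 1 := by revert i; decide
lemma n01 (i : Fin 3) : i ≠ i + 1 := by revert i; decide
lemma n02 (i : Fin 3) : i ≠ i + 2 := by revert i; decide
lemma n12 (i : Fin 3) : i + 1 ≠ i + 2 := by revert i; decide

lemma dot_eq (u v : V2) : dot u v = u 0 * v 0 + u 1 * v 1 := by
  simp [dot, Fin.sum_univ_two]

lemma polyDeg_add {k : ℕ} {f g : V2 → ℝ} (hf : PolyDeg k f) (hg : PolyDeg k g) :
    PolyDeg k (fun x => f x + g x) := by
  obtain ⟨p, hp, hp'⟩ := hf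
  obtain ⟨q, hq, hq'⟩ := hg
  exact ⟨p + q, (MvPolynomial.totalDegree_add _ _).trans (max_le hp hq), fun x => by
    simp [hp', hq']⟩

lemma polyDeg_mul {k l : ℕ} {f g : V2 → ℝ} (hf : PolyDeg k f) (hg : PolyDeg l g) :
    PolyDeg (k + l) (fun x => f x * g x) := by
  obtain ⟨p, hp, hp'⟩ := hf
  obtain ⟨q, hq, hq'⟩ := hg
  exact ⟨p * q, (MvPolynomial.totalDegree_mul _ _).trans (add_le_add hp hq), fun x => by
    simp [hp', hq']⟩

lemma polyDeg_const (k : ℕ) (c : ℝ) : PolyDeg k (fun _ => c) :=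
  ⟨MvPolynomial.C c, by simp, fun x => by simp⟩

lemma polyDeg_mono {k l : ℕ} (h : k ≤ l) {f : V2 → ℝ} (hf : PolyDeg k f) : PolyDeg l f := by
  obtain ⟨p, hp, hp'⟩ := hf
  exact ⟨p, hp.trans h, hp'⟩

lemma polyDeg_sum {k : ℕ} {ι : Type*} (s : Finset ι) {f : ι → V2 → ℝ}
    (hf : ∀ i, PolyDeg k (f i)) : PolyDeg k (fun x => ∑ i ∈ s, f i x) := by
  classical
  induction s using Finset.induction_on with
  | empty => simpa using polyDeg_const k 0
  | insert a s ha ih =>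
    simp only [Finset.sum_insert ha]
    exact polyDeg_add (hf a) ih

lemma polyDeg_mem {k : ℕ} (S : Submodule ℝ (V2 → ℝ))
    (hS : ∀ a b : ℕ, a + b ≤ k → (fun x : V2 => x 0 ^ a * x 1 ^ b) ∈ S)
    {f : V2 → ℝ} (hf : PolyDeg k f) : f ∈ S := by
  obtain ⟨p, hp, hp'⟩ := hf
  have : f = ∑ m ∈ p.support, p.coeff m • (fun x : V2 => x 0 ^ (m 0) * x 1 ^ (m 1)) := by
    funext x
    rw [hp', MvPolynomial.eval_eq']
    simp [Fin.prod_univ_two]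
  rw [this]
  refine Submodule.sum_mem _ fun m hm => Submodule.smul_mem _ _ (hS _ _ ?_)
  have := MvPolynomial.le_totalDegree hm
  rw [Finsupp.sum_fintype _ _ (by simp), Fin.sum_univ_two] at this
  omega

/-- affine functions as a submodule -/
def affS : Submodule ℝ (V2 → ℝ) where
  carrier := {f | ∃ a b c : ℝ, ∀ x, f x = a * x 0 + b * x 1 + c}
  add_mem' := by
    rintro f g ⟨a, b, c, h⟩ ⟨a', b', c', h'⟩
    exact ⟨a + a', b + b', c + c', fun x => by simp [h, h']; ring⟩
  zero_mem' := ⟨0, 0, 0, fun x => by simp⟩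
  smul_mem' := by
    rintro r f ⟨a, b, c, h⟩
    exact ⟨r * a, r * b, r * c, fun x => by simp [h]; ring⟩

lemma polyDeg_one {f : V2 → ℝ} (hf : PolyDeg 1 f) :
    ∃ a b c : ℝ, ∀ x, f x = a * x 0 + b * x 1 + c := by
  refine polyDeg_mem affS ?_ hf
  intro a b hab
  have : (a = 0 ∧ b = 0) ∨ (a = 1 ∧ b = 0) ∨ (a = 0 ∧ b = 1) := by omega
  rcases this with ⟨rfl, rfl⟩ | ⟨rfl, rfl⟩ | ⟨rfl, rfl⟩
  · exact ⟨0, 0, 1, fun x => by simp⟩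
  · exact ⟨1, 0, 0, fun x => by simp⟩
  · exact ⟨0, 1, 0, fun x => by simp⟩

variable (T : TriangleData)

lemma lam_repr (x : V2) (j : Fin 2) : x j = ∑ i, T.lam i x * T.A i j := by
  have htop : affineSpan ℝ (Set.range T.A) = ⊤ := by
    rw [T.indep.affineSpan_eq_top_iff_card_eq_finrank_add_one]
    simp
  let B : AffineBasis (Fin 3) ℝ V2 := ⟨T.A, T.indep, htop⟩
  have h1 : ∑ i, B.coord i x • T.A i = x := B.linear_combination_coord_eq_self x
  have h2 : ∑ i, B.coord i x = 1 := B.sum_coord_apply_eq_one x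
  have hx : ∀ j, x j = ∑ i, B.coord i x * T.A i j := by
    intro j
    conv_lhs => rw [← h1]
    simp
  have hl : ∀ i, T.lam i x = B.coord i x := by
    intro i
    obtain ⟨a, b, c, h⟩ := polyDeg_one (T.lam_poly i)
    have : T.lam i x = ∑ k, B.coord k x * T.lam i (T.A k) := by
      simp only [h]
      rw [hx 0, hx 1]
      rw [Fin.sum_univ_three] at h2 ⊢
      simp only [Fin.sum_univ_three]
      linear_combination (-c) * h2
    rw [this]
    simp [T.lam_vertex]
  simp only [hl]
  exact hx j

/-- quadratics in barycentric form -/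
def quadS : Submodule ℝ (V2 → ℝ) where
  carrier := {f | ∃ a b : Fin 3 → ℝ, ∀ x, f x = ∑ i, T.lam i x * a i +
    ∑ i, (T.lam (i + 1) x * T.lam (i + 2) x) * b i}
  add_mem' := by
    rintro f g ⟨a, b, h⟩ ⟨a', b', h'⟩
    exact ⟨a + a', b + b', fun x => by simp [h, h', mul_add, Finset.sum_add_distrib]; ring⟩
  zero_mem' := ⟨0, 0, fun x => by simp⟩
  smul_mem' := by
    rintro r f ⟨a, b, h⟩
    exact ⟨r • a, r • b, fun x => by simp [h, mul_add, Finset.mul_sum, mul_left_comm]⟩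

lemma quadS_mul (a b : Fin 3 → ℝ) :
    (fun x => (∑ i, T.lam i x * a i) * (∑ i, T.lam i x * b i)) ∈ T.quadS := by
  refine ⟨fun i => a i * b i, fun i => a (i + 1) * b (i + 2) + a (i + 2) * b (i + 1)
    - a (i + 1) * b (i + 1) - a (i + 2) * b (i + 2), fun x => ?_⟩
  have h := T.lam_sum x
  simp only [Fin.sum_univ_three] at h ⊢
  simp only [show (0 : Fin 3) + 1 = 1 from rfl, show (0 : Fin 3) + 2 = 2 from rfl,
    show (1 : Fin 3) + 1 = 2 from rfl, show (1 : Fin 3) + 2 = 0 from rfl,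
    show (2 : Fin 3) + 1 = 0 from rfl, show (2 : Fin 3) + 2 = 1 from rfl]
  linear_combination (T.lam 0 x * a 0 * b 0 + T.lam 1 x * a 1 * b 1 + T.lam 2 x * a 2 * b 2) * h

lemma polyDeg_two {f : V2 → ℝ} (hf : PolyDeg 2 f) :
    ∃ a b : Fin 3 → ℝ, ∀ x, f x = ∑ i, T.lam i x * a i +
      ∑ i, (T.lam (i + 1) x * T.lam (i + 2) x) * b i := by
  refine polyDeg_mem T.quadS ?_ hf
  have one : ∀ x, (1 : ℝ) = ∑ i, T.lam i x * (fun _ => (1 : ℝ)) i := fun x => by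
    simp [T.lam_sum x]
  have key : ∀ (g h : V2 → ℝ) (a b : Fin 3 → ℝ), (∀ x, g x = ∑ i, T.lam i x * a i) →
      (∀ x, h x = ∑ i, T.lam i x * b i) → (fun x => g x * h x) ∈ T.quadS := by
    intro g h a b hg hh
    simp only [hg, hh]
    exact T.quadS_mul a b
  intro a b hab
  have e0 := fun x => T.lam_repr x 0
  have e1 := fun x => T.lam_repr x 1
  have : (a = 0 ∧ b = 0) ∨ (a = 1 ∧ b = 0) ∨ (a = 0 ∧ b = 1) ∨ (a = 2 ∧ b = 0) ∨
    (a = 1 ∧ b = 1) ∨ (a = 0 ∧ b = 2) := by omega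
  rcases this with ⟨rfl, rfl⟩ | ⟨rfl, rfl⟩ | ⟨rfl, rfl⟩ | ⟨rfl, rfl⟩ | ⟨rfl, rfl⟩ | ⟨rfl, rfl⟩
  · simpa using key _ _ _ _ one one
  · simpa using key _ _ _ _ e0 one
  · simpa using key _ _ _ _ one e1
  · simpa [sq] using key _ _ _ _ e0 e0
  · simpa using key _ _ _ _ e0 e1
  · simpa [sq] using key _ _ _ _ e1 e1

/-- edge vectors -/
def dv (i : Fin 3) : V2 := T.A (i + 2) - T.A (i + 1)

lemma lam_Ept (i j : Fin 3) (t : ℝ) :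
    T.lam j (T.Ept i t) = (1 - t) * T.lam j (T.A (i + 1)) + t * T.lam j (T.A (i + 2)) := by
  obtain ⟨a, b, c, h⟩ := polyDeg_one (T.lam_poly j)
  simp only [h, Ept, PiLp.add_apply, PiLp.smul_apply, PiLp.sub_apply, smul_eq_mul]
  ring

lemma lam_E0 (i : Fin 3) (t : ℝ) : T.lam i (T.Ept i t) = 0 := by
  rw [lam_Ept, T.lam_vertex, T.lam_vertex, if_neg (n01 i), if_neg (n02 i)]; simp
lemma lam_E1 (i : Fin 3) (t : ℝ) : T.lam (i + 1) (T.Ept i t) = 1 - t := by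
  rw [lam_Ept, T.lam_vertex, T.lam_vertex, if_pos rfl, if_neg (n12 i)]; simp
lemma lam_E2 (i : Fin 3) (t : ℝ) : T.lam (i + 2) (T.Ept i t) = t := by
  rw [lam_Ept, T.lam_vertex, T.lam_vertex, if_pos rfl, if_neg (n12 i).symm]; simp

/-- vector quadratic in barycentric form -/
def QF (a b : Fin 3 → V2) (x : V2) : V2 :=
  ∑ i, T.lam i x • a i + ∑ i, (T.lam (i + 1) x * T.lam (i + 2) x) • b i

lemma QF_E (a b : Fin 3 → V2) (i : Fin 3) (t : ℝ) :
    T.QF a b (T.Ept i t) = (1 - t) • a (i + 1) + t • a (i + 2) + ((1 - t) * t) • b i := by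
  unfold QF
  rw [aux_sum3 _ i, aux_sum3 (fun j => (_ : ℝ) • b j) i]
  simp only [f11, f12, f21, f22, lam_E0, lam_E1, lam_E2]
  simp

lemma QF_poly (a b : Fin 3 → V2) : PolyVecDeg 2 (T.QF a b) := by
  intro j
  have : (fun x => T.QF a b x j) = fun x => ∑ i, T.lam i x * a i j +
      ∑ i, (T.lam (i + 1) x * T.lam (i + 2) x) * b i j := by
    funext x; simp [QF]
  rw [this]
  refine polyDeg_add (polyDeg_sum _ fun i => ?_) (polyDeg_sum _ fun i => ?_)
  · exact polyDeg_mul (T.lam_poly i) (polyDeg_const 1 _)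
  · exact polyDeg_mul (k := 2) (l := 0) (polyDeg_mul (T.lam_poly _) (T.lam_poly _))
      (polyDeg_const 0 _)

lemma exists_QF {q : V2 → V2} (hq : PolyVecDeg 2 q) : ∃ a b, q = T.QF a b := by
  have := fun j => T.polyDeg_two (hq j)
  choose a b h using this
  refine ⟨fun i => WithLp.toLp 2 fun j => a j i, fun i => WithLp.toLp 2 fun j => b j i, ?_⟩
  funext x
  ext j
  simp [QF, h]

/-! ### planar geometry -/

lemma nv_sq (i : Fin 3) : T.nv i 0 ^ 2 + T.nv i 1 ^ 2 = 1 := by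
  have := EuclideanSpace.norm_sq_eq (T.nv i)
  rw [T.nv_unit i, Fin.sum_univ_two] at this
  simpa using this.symm

lemma nv_dv (i : Fin 3) : dot (T.nv i) (T.dv i) = 0 := T.nv_orth i

lemma nv_dv2 (i : Fin 3) : dot (T.nv i) (T.dv (i + 2)) ≠ 0 := by
  have h := T.nv_outward i
  unfold dv
  rw [f21, f22]
  simp only [dot_eq, PiLp.sub_apply] at h ⊢
  intro h'
  linarith

lemma nv_dv1 (i : Fin 3) : dot (T.nv i) (T.dv (i + 1)) ≠ 0 := by
  have h := T.nv_dv2 i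
  have h0 := T.nv_dv i
  unfold dv at *
  rw [f21, f22] at h
  rw [f11, f12]
  simp only [dot_eq, PiLp.sub_apply] at h h0 ⊢
  intro h'
  apply h
  linarith

lemma dv_ne (i : Fin 3) : T.dv i ≠ 0 := by
  intro h
  have := T.nv_dv1 (i + 2)
  rw [f21, h] at this
  simp [dot_eq] at this

lemma dv_sq_pos (i : Fin 3) : 0 < dot (T.dv i) (T.dv i) := by
  have h := T.dv_ne i
  rw [dot_eq]
  by_contra hc
  apply h
  have h0 : T.dv i 0 = 0 := by nlinarith [mul_self_nonneg (T.dv i 0), mul_self_nonneg (T.dv i 1)]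
  have h1 : T.dv i 1 = 0 := by nlinarith [mul_self_nonneg (T.dv i 0), mul_self_nonneg (T.dv i 1)]
  ext j
  fin_cases j <;> simp [h0, h1]

lemma exists_smul_dv (i : Fin 3) (v : V2) (hv : dot v (T.nv i) = 0) :
    ∃ c : ℝ, v = c • T.dv i := by
  have hp := T.dv_sq_pos i
  have ho := T.nv_dv i
  have hn := T.nv_sq i
  rw [dot_eq] at *
  have hc : T.dv i 0 * v 1 - T.dv i 1 * v 0 = 0 := by
    linear_combination (-(T.dv i 0 * v 1 - T.dv i 1 * v 0)) * hn +
      (T.nv i 0 * v 1 - T.nv i 1 * v 0) * ho + (T.nv i 1 * T.dv i 0 - T.nv i 0 * T.dv i 1) * hv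
  refine ⟨(v 0 * T.dv i 0 + v 1 * T.dv i 1) / (T.dv i 0 * T.dv i 0 + T.dv i 1 * T.dv i 1), ?_⟩
  ext j
  fin_cases j
  · simp only [Fin.zero_eta, Fin.mk_one, PiLp.smul_apply, smul_eq_mul]
    rw [div_mul_eq_mul_div, eq_div_iff hp.ne']
    linear_combination (-T.dv i 1) * hc
  · simp only [Fin.zero_eta, Fin.mk_one, PiLp.smul_apply, smul_eq_mul]
    rw [div_mul_eq_mul_div, eq_div_iff hp.ne']
    linear_combination (T.dv i 0) * hc

lemma eq_zero_of_dots (i : Fin 3) (v : V2) (h1 : dot v (T.nv (i + 1)) = 0)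
    (h2 : dot v (T.nv (i + 2)) = 0) : v = 0 := by
  obtain ⟨c, rfl⟩ := T.exists_smul_dv _ _ h1
  have h := T.nv_dv2 (i + 2)
  rw [f22] at h
  have : c * dot (T.nv (i + 2)) (T.dv (i + 1)) = 0 := by
    rw [← h2]; simp [dot_eq]; ring
  rcases mul_eq_zero.1 this with h' | h'
  · simp [h']
  · exact absurd h' h

/-! ### normal derivatives -/

lemma lam_deriv (i : Fin 3) : ∃ L : V2 →L[ℝ] ℝ, (∀ x, HasFDerivAt (T.lam i) L x) ∧
    L (T.nv i) ≠ 0 := by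
  obtain ⟨a, b, c, h⟩ := polyDeg_one (T.lam_poly i)
  refine ⟨a • EuclideanSpace.proj (𝕜 := ℝ) 0 + b • EuclideanSpace.proj (𝕜 := ℝ) 1, fun x => ?_, ?_⟩
  · rw [show T.lam i = fun x => (a • (EuclideanSpace.proj 0 : V2 →L[ℝ] ℝ) +
      b • (EuclideanSpace.proj 1 : V2 →L[ℝ] ℝ)) x + c by funext x; simp [h]]
    exact (ContinuousLinearMap.hasFDerivAt _).add_const c
  · simp
    intro h0
    have v0 := T.lam_vertex i i
    have v1 := T.lam_vertex i (i + 1)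
    have v2 := T.lam_vertex i (i + 2)
    rw [if_pos rfl, h] at v0
    rw [if_neg (n01 i), h] at v1
    rw [if_neg (n02 i), h] at v2
    have hv := T.eq_zero_of_dots i (WithLp.toLp 2 ![a, b])
    have ho := T.nv_dv i
    have hn := T.nv_sq i
    have hp := T.dv_sq_pos i
    have hd : a * T.dv i 0 + b * T.dv i 1 = 0 := by
      simp [dv]; linarith
    rw [dot_eq] at ho hp
    have hdet : (T.nv i 0 * T.dv i 1 - T.nv i 1 * T.dv i 0) ≠ 0 := by
      intro hz
      have : (T.nv i 0 ^ 2 + T.nv i 1 ^ 2) *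
        (T.dv i 0 * T.dv i 0 + T.dv i 1 * T.dv i 1) = 0 := by
        linear_combination (T.nv i 0 * T.dv i 0 + T.nv i 1 * T.dv i 1) * ho +
          (T.nv i 0 * T.dv i 1 - T.nv i 1 * T.dv i 0) * hz
      rw [hn] at this
      linarith
    have ha : a = 0 := by
      refine (mul_eq_zero.1 (?_ : a * (T.nv i 0 * T.dv i 1 - T.nv i 1 * T.dv i 0) = 0)).resolve_right hdet
      linear_combination (T.dv i 1) * h0 - T.nv i 1 * hd
    have hb : b = 0 := by
      refine (mul_eq_zero.1 (?_ : b * (T.nv i 0 * T.dv i 1 - T.nv i 1 * T.dv i 0) = 0)).resolve_right hdet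
      linear_combination (-T.dv i 0) * h0 + T.nv i 0 * hd
    subst ha hb
    linarith

lemma lam_diff (i : Fin 3) : Differentiable ℝ (T.lam i) := fun x => by
  obtain ⟨L, hL, -⟩ := T.lam_deriv i
  exact (hL x).differentiableAt

lemma nder_bub (i : Fin 3) : ∃ κ : ℝ, κ ≠ 0 ∧ ∀ (a b : Fin 3 → V2) (v : V2) (t : ℝ),
    T.nder (fun x => dot (T.bub x • T.QF a b x) v) i t =
      κ * ((1 - t) * t * ((1 - t) * dot (a (i + 1)) v + t * dot (a (i + 2)) v +
        (1 - t) * t * dot (b i) v)) := by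
  obtain ⟨L, hL, hne⟩ := T.lam_deriv i
  refine ⟨L (T.nv i), hne, fun a b v t => ?_⟩
  have hf : (fun x => dot (T.bub x • T.QF a b x) v) = fun x => T.lam i x *
      ((T.lam (i + 1) x * T.lam (i + 2) x) * dot (T.QF a b x) v) := by
    funext x
    simp only [bub, aux_prod3 _ i, dot_eq, PiLp.smul_apply, smul_eq_mul]
    ring
  have hd : DifferentiableAt ℝ (fun x => (T.lam (i + 1) x * T.lam (i + 2) x) *
      dot (T.QF a b x) v) (T.Ept i t) := by
    have h0 := T.lam_diff 0
    have h1 := T.lam_diff 1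
    have h2 := T.lam_diff 2
    have hh := T.lam_diff (i + 1)
    have hh' := T.lam_diff (i + 2)
    simp only [dot_eq, QF, Fin.sum_univ_three, PiLp.add_apply, PiLp.smul_apply, smul_eq_mul,
      show (0 : Fin 3) + 1 = 1 from rfl, show (0 : Fin 3) + 2 = 2 from rfl,
      show (1 : Fin 3) + 1 = 2 from rfl, show (1 : Fin 3) + 2 = 0 from rfl,
      show (2 : Fin 3) + 1 = 0 from rfl, show (2 : Fin 3) + 2 = 1 from rfl]
    fun_prop
  unfold nder
  rw [hf]
  erw [((hL (T.Ept i t)).mul hd.hasFDerivAt).fderiv]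
  simp only [lam_E0, lam_E1, lam_E2, QF_E]
  simp [dot_eq]
  ring

/-! ### parametrization -/

abbrev Par := (Fin 3 → V2) × (Fin 3 → V2) × (Fin 3 → V2) × (Fin 3 → ℝ)

/-- explicit parametrization of `W(T)` -/
def Phi : Par →ₗ[ℝ] (V2 → V2) where
  toFun u x := T.QF u.1 u.2.1 x + T.bub x • T.QF u.2.2.1 (fun i => u.2.2.2 i • T.dv i) x
  map_add' u v := by
    funext x
    ext j
    simp only [QF, Fin.sum_univ_three, PiLp.add_apply, PiLp.smul_apply, smul_eq_mul, Pi.add_apply,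
      Prod.fst_add, Prod.snd_add]
    ring
  map_smul' r u := by
    funext x
    ext j
    simp only [QF, Fin.sum_univ_three, PiLp.add_apply, PiLp.smul_apply, smul_eq_mul, Pi.smul_apply,
      Prod.smul_fst, Prod.smul_snd, RingHom.id_apply]
    ring

lemma Phi_apply (u : Par) (x : V2) : T.Phi u x =
    T.QF u.1 u.2.1 x + T.bub x • T.QF u.2.2.1 (fun i => u.2.2.2 i • T.dv i) x := rfl

lemma memW1_iff (w : V2 → V2) : T.memW1 w ↔ ∃ u, T.Phi u = w := by
  constructor
  · rintro ⟨q, p, hq, ⟨hp, hp'⟩, hw⟩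
    obtain ⟨a, b, rfl⟩ := T.exists_QF hq
    obtain ⟨g, d, rfl⟩ := T.exists_QF hp
    have : ∀ i, ∃ c : ℝ, d i = c • T.dv i := by
      intro i
      apply T.exists_smul_dv
      obtain ⟨r, s, h⟩ := hp' i
      have h0 := h 0
      have h1 := h 1
      have h2 := h (-1)
      simp only [QF_E, dot_eq, PiLp.add_apply, PiLp.smul_apply, smul_eq_mul] at h0 h1 h2 ⊢
      linarith
    choose c hc using this
    refine ⟨(a, b, g, c), ?_⟩
    funext x
    rw [hw, Phi_apply]
    simp only [← hc]
  · rintro ⟨u, rfl⟩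
    refine ⟨_, _, T.QF_poly _ _, ⟨T.QF_poly _ _, fun i => ?_⟩, T.Phi_apply u⟩
    refine ⟨dot (u.2.2.1 (i + 2)) (T.nv i) - dot (u.2.2.1 (i + 1)) (T.nv i),
      dot (u.2.2.1 (i + 1)) (T.nv i), fun t => ?_⟩
    have h := T.nv_dv i
    simp only [QF_E, dot_eq, PiLp.add_apply, PiLp.smul_apply, smul_eq_mul] at h ⊢
    linear_combination ((1 - t) * t * u.2.2.2 i) * h

lemma bub_E (i : Fin 3) (t : ℝ) : T.bub (T.Ept i t) = 0 := by
  rw [bub, aux_prod3 _ i, lam_E0, zero_mul]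

lemma int_poly (c0 c1 c2 c3 c4 : ℝ) :
    ∫ t in (0 : ℝ)..1, (c0 + c1 * t + c2 * t ^ 2 + c3 * t ^ 3 + c4 * t ^ 4) =
      c0 + c1 / 2 + c2 / 3 + c3 / 4 + c4 / 5 := by
  have hd : ∀ t ∈ Set.uIcc (0 : ℝ) 1, HasDerivAt (fun t : ℝ => c0 * t + c1 / 2 * t ^ 2 +
      c2 / 3 * t ^ 3 + c3 / 4 * t ^ 4 + c4 / 5 * t ^ 5)
      (c0 + c1 * t + c2 * t ^ 2 + c3 * t ^ 3 + c4 * t ^ 4) t := by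
    intro t _
    have := (((((hasDerivAt_id t).const_mul c0).add ((hasDerivAt_pow 2 t).const_mul (c1 / 2))).add
      ((hasDerivAt_pow 3 t).const_mul (c2 / 3))).add
      ((hasDerivAt_pow 4 t).const_mul (c3 / 4))).add ((hasDerivAt_pow 5 t).const_mul (c4 / 5))
    refine HasDerivAt.congr_deriv this ?_
    norm_num
    ring
  rw [intervalIntegral.integral_eq_sub_of_hasDerivAt hd
    (Continuous.intervalIntegrable (by fun_prop) _ _)]
  norm_num

lemma main (u : Par) (h : T.dofsVanish (T.Phi u)) : u = 0 := by
  obtain ⟨a, b, g, c⟩ := u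
  obtain ⟨hA, hM, ht, hn⟩ := h
  have ha : a = 0 := by
    funext i
    have e : T.A i = T.Ept (i + 2) 0 := by simp [Ept, f21]
    have := hA i
    rw [e, Phi_apply, bub_E, QF_E] at this
    simpa [f21] using this
  subst ha
  have hb : b = 0 := by
    funext i
    have e : T.mid i = T.Ept i (1 / 2) := by
      rw [mid, midpoint_eq_smul_add, Ept]
      ext j
      simp
      ring
    have := hM i
    rw [e, Phi_apply, bub_E, QF_E] at this
    norm_num at this
    simpa using this
  subst hb
  have hw : ∀ x, T.Phi (0, 0, g, c) x = T.bub x • T.QF g (fun i => c i • T.dv i) x := by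
    intro x
    simp [Phi_apply, QF]
  simp only [hw] at ht hn
  have hgn : ∀ i, dot (g (i + 1)) (T.nv i) = 0 ∧ dot (g (i + 2)) (T.nv i) = 0 := by
    intro i
    obtain ⟨κ, hκ, hk⟩ := T.nder_bub i
    have h0 := hn i 0
    have h1 := hn i 1
    have hz : dot (c i • T.dv i) (T.nv i) = 0 := by
      have h := T.nv_dv i
      simp only [dot_eq, PiLp.smul_apply, smul_eq_mul] at h ⊢
      linear_combination c i * h
    simp only [hk, hz] at h0 h1
    set P := dot (g (i + 1)) (T.nv i)
    set Q := dot (g (i + 2)) (T.nv i)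
    have i0 := int_poly 0 (κ * P) (κ * (Q - 2 * P)) (κ * (P - Q)) 0
    have i1 := int_poly 0 0 (κ * P) (κ * (Q - 2 * P)) (κ * (P - Q))
    rw [intervalIntegral.integral_congr (g := fun t => 0 + (κ * P) * t + (κ * (Q - 2 * P)) * t ^ 2 +
      (κ * (P - Q)) * t ^ 3 + 0 * t ^ 4) (fun t _ => by simp; ring), i0] at h0
    rw [intervalIntegral.integral_congr (g := fun t => 0 + 0 * t + (κ * P) * t ^ 2 +
      (κ * (Q - 2 * P)) * t ^ 3 + (κ * (P - Q)) * t ^ 4) (fun t _ => by simp; ring), i1] at h1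
    constructor
    · exact (mul_eq_zero.1 (by linarith : κ * P = 0)).resolve_left hκ
    · exact (mul_eq_zero.1 (by linarith : κ * Q = 0)).resolve_left hκ
  have hg : g = 0 := by
    funext i
    refine T.eq_zero_of_dots i _ ?_ ?_
    · simpa [f12] using (hgn (i + 1)).2
    · simpa [f21] using (hgn (i + 2)).1
  subst hg
  have hc : c = 0 := by
    funext i
    obtain ⟨κ, hκ, hk⟩ := T.nder_bub i
    have h0 := ht i
    simp only [hk] at h0
    have hp := T.dv_sq_pos i
    have hl : 0 < ‖T.dv i‖ := norm_pos_iff.2 (T.dv_ne i)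
    have hz : dot (c i • T.dv i) (T.tv i) = c i * (‖T.dv i‖⁻¹ * dot (T.dv i) (T.dv i)) := by
      simp [dot_eq, tv, dv]; ring
    rw [hz] at h0
    set P := c i * (‖T.dv i‖⁻¹ * dot (T.dv i) (T.dv i)) with hP
    have i0 := int_poly 0 0 (κ * P) (-2 * (κ * P)) (κ * P)
    rw [intervalIntegral.integral_congr (g := fun t => 0 + 0 * t + (κ * P) * t ^ 2 +
      (-2 * (κ * P)) * t ^ 3 + (κ * P) * t ^ 4) (fun t _ => by simp [dot_eq]; ring), i0] at h0
    have : P = 0 := (mul_eq_zero.1 (by linarith : κ * P = 0)).resolve_left hκ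
    rw [hP] at this
    exact (mul_eq_zero.1 this).resolve_right (by positivity)
  subst hc
  rfl

lemma dofs_zero : T.dofsVanish (0 : V2 → V2) := by
  have : ∀ v : V2, (fun x : V2 => dot ((0 : V2 → V2) x) v) = fun _ => 0 := by
    intro v; funext x; simp [dot_eq]
  simp only [dofsVanish, this, nder]
  simp

lemma Phi_inj : Function.Injective T.Phi := by
  rw [injective_iff_map_eq_zero]
  intro u hu
  exact T.main u (hu ▸ T.dofs_zero)

end TriangleData

/-- Unisolvency of the first element: `W(T) = [P₂(T)]² ⊕ b·P₂*(T)` has dimension `21`,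
and any `w ∈ W(T)` is uniquely determined by the 21 degrees of freedom (vertex and
midpoint values, edge moments of normal derivatives): if they all vanish then `w = 0`. -/
theorem stmt9 (T : TriangleData) :
    Module.finrank ℝ (Submodule.span ℝ {w : V2 → V2 | T.memW1 w}) = 21 ∧
      ∀ w : V2 → V2, T.memW1 w → T.dofsVanish w → w = 0 := by
  constructor
  · have : Submodule.span ℝ {w : V2 → V2 | T.memW1 w} = LinearMap.range T.Phi := by
      rw [show {w : V2 → V2 | T.memW1 w} = (LinearMap.range T.Phi : Set (V2 → V2)) by
        ext w; simp [T.memW1_iff]]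
      exact Submodule.span_eq _
    rw [this, LinearMap.finrank_range_of_inj T.Phi_inj]
    simp [TriangleData.Par, Module.finrank_pi_fintype]
  · intro w hw hd
    obtain ⟨u, rfl⟩ := (T.memW1_iff w).1 hw
    rw [T.main u hd, map_zero]
end
end

section
/- Unisolvency of the second element: let T be a triangle, b the cubic bubble, and W(T) = [P₂(T)]² ⊕ b·P₃*(T), where P₃*(T) = {w ∈ [P₃(T)]² : ∇·w ∈ P₀(T), (w·n)|_e ∈ P₁(e) for every edge e}. Then dim W(T) = 21 and any w ∈ W(T) is uniquely determined by: values at the 3 vertices and 3 edge midpoints, the moments ∫_e ∂_n(w·t) dτ, and the moments ∫_e ∂_n(w·n) τ^k dτ, k = 0,1, over each edge. -/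
open MeasureTheory

noncomputable section

/-! ### Polynomials -/

lemma PolyDeg.const (k : ℕ) (a : ℝ) : PolyDeg k (fun _ => a) :=
  ⟨MvPolynomial.C a, by simp, by simp⟩

lemma PolyDeg.congr {k : ℕ} {f g : V2 → ℝ} (hf : PolyDeg k f) (h : ∀ x, g x = f x) :
    PolyDeg k g := by
  have : g = f := funext h
  rw [this]; exact hf

lemma PolyDeg.mono {k l : ℕ} {f : V2 → ℝ} (hf : PolyDeg k f) (h : k ≤ l) : PolyDeg l f := by
  obtain ⟨p, hp, he⟩ := hf
  exact ⟨p, hp.trans h, he⟩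

lemma PolyDeg.add {k : ℕ} {f g : V2 → ℝ} (hf : PolyDeg k f) (hg : PolyDeg k g) :
    PolyDeg k (fun x => f x + g x) := by
  obtain ⟨p, hp, he⟩ := hf
  obtain ⟨q, hq, he'⟩ := hg
  exact ⟨p + q, (MvPolynomial.totalDegree_add _ _).trans (max_le hp hq), fun x => by
    simp [he, he']⟩

lemma PolyDeg.mul {k l : ℕ} {f g : V2 → ℝ} (hf : PolyDeg k f) (hg : PolyDeg l g) :
    PolyDeg (k + l) (fun x => f x * g x) := by
  obtain ⟨p, hp, he⟩ := hf
  obtain ⟨q, hq, he'⟩ := hg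
  exact ⟨p * q, (MvPolynomial.totalDegree_mul _ _).trans (add_le_add hp hq), fun x => by
    simp [he, he']⟩

lemma PolyDeg.cmul {k : ℕ} {f : V2 → ℝ} (a : ℝ) (hf : PolyDeg k f) :
    PolyDeg k (fun x => a * f x) := by
  have := (PolyDeg.const 0 a).mul hf
  rwa [zero_add] at this

lemma PolyDeg.pow {f : V2 → ℝ} (hf : PolyDeg 1 f) (n : ℕ) :
    PolyDeg n (fun x => f x ^ n) := by
  induction n with
  | zero => simpa using PolyDeg.const 0 1
  | succ n ih => exact (ih.mul hf).congr fun x => by ring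

/-- Expansion of a polynomial in two variables of total degree at most `k`. -/
lemma mv_expand (k : ℕ) (p : MvPolynomial (Fin 2) ℝ) (hp : p.totalDegree ≤ k) :
    ∃ c : ℕ → ℕ → ℝ, ∀ z : Fin 2 → ℝ, MvPolynomial.eval z p =
      ∑ i ∈ Finset.range (k + 1), ∑ j ∈ Finset.range (k + 1 - i),
        c i j * (z 0 ^ i * z 1 ^ j) := by
  refine ⟨fun i j => ∑ d ∈ p.support, if d 0 = i ∧ d 1 = j then p.coeff d else 0, fun z => ?_⟩
  rw [MvPolynomial.eval_eq']
  simp only [Finset.sum_mul, Fin.prod_univ_two]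
  have : ∀ i ∈ Finset.range (k + 1), (∑ j ∈ Finset.range (k + 1 - i), ∑ d ∈ p.support,
      (if d 0 = i ∧ d 1 = j then p.coeff d else 0) * (z 0 ^ i * z 1 ^ j)) =
      ∑ d ∈ p.support, ∑ j ∈ Finset.range (k + 1 - i),
        (if d 0 = i ∧ d 1 = j then p.coeff d else 0) * (z 0 ^ i * z 1 ^ j) :=
    fun i _ => Finset.sum_comm
  rw [Finset.sum_congr rfl this, Finset.sum_comm]
  refine Finset.sum_congr rfl fun d hd => ?_
  have hdeg : d 0 + d 1 ≤ k := by
    have h1 := MvPolynomial.le_totalDegree hd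
    rw [Finsupp.sum_fintype _ _ (fun _ => rfl), Fin.sum_univ_two] at h1
    omega
  rw [Finset.sum_eq_single_of_mem (d 0) (by simp; omega), Finset.sum_eq_single_of_mem (d 1)]
  · simp
  · simp; omega
  · intro j _ hj
    rw [if_neg, zero_mul]
    exact fun h => hj h.2.symm
  · intro i _ hi
    refine Finset.sum_eq_zero fun j _ => ?_
    rw [if_neg, zero_mul]
    exact fun h => hi h.1.symm

/-- Affine substitution does not raise the degree. -/
lemma mv_subst (k : ℕ) (p : MvPolynomial (Fin 2) ℝ) (hp : p.totalDegree ≤ k)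
    (l : Fin 2 → MvPolynomial (Fin 2) ℝ) (hl : ∀ i, (l i).totalDegree ≤ 1) :
    (MvPolynomial.aeval l p).totalDegree ≤ k := by
  rw [MvPolynomial.aeval_def, MvPolynomial.eval₂_eq']
  refine MvPolynomial.totalDegree_finsetSum_le fun d hd => ?_
  have hdeg : d 0 + d 1 ≤ k := by
    have h1 := MvPolynomial.le_totalDegree hd
    rw [Finsupp.sum_fintype _ _ (fun _ => rfl), Fin.sum_univ_two] at h1
    omega
  refine (MvPolynomial.totalDegree_mul _ _).trans ?_
  rw [MvPolynomial.algebraMap_eq, MvPolynomial.totalDegree_C, Fin.prod_univ_two, zero_add]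
  refine (MvPolynomial.totalDegree_mul _ _).trans ?_
  have h0 := MvPolynomial.totalDegree_pow (l 0) (d 0)
  have h1 := MvPolynomial.totalDegree_pow (l 1) (d 1)
  have h2 := Nat.mul_le_mul_left (d 0) (hl 0)
  have h3 := Nat.mul_le_mul_left (d 1) (hl 1)
  omega

/-! ### Affine coordinates -/

/-- Coordinates on the triangle: `lam 1`, `lam 2` as affine functions. -/
structure Coord (T : TriangleData) where
  a₁ : ℝ
  b₁ : ℝ
  a₂ : ℝ
  b₂ : ℝ
  lam1 : ∀ x, T.lam 1 x = a₁ * (x 0 - T.A 0 0) + b₁ * (x 1 - T.A 0 1)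
  lam2 : ∀ x, T.lam 2 x = a₂ * (x 0 - T.A 0 0) + b₂ * (x 1 - T.A 0 1)
  e00 : (T.A 1 0 - T.A 0 0) * a₁ + (T.A 2 0 - T.A 0 0) * a₂ = 1
  e01 : (T.A 1 0 - T.A 0 0) * b₁ + (T.A 2 0 - T.A 0 0) * b₂ = 0
  e10 : (T.A 1 1 - T.A 0 1) * a₁ + (T.A 2 1 - T.A 0 1) * a₂ = 0
  e11 : (T.A 1 1 - T.A 0 1) * b₁ + (T.A 2 1 - T.A 0 1) * b₂ = 1
  d11 : a₁ * (T.A 1 0 - T.A 0 0) + b₁ * (T.A 1 1 - T.A 0 1) = 1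
  d12 : a₁ * (T.A 2 0 - T.A 0 0) + b₁ * (T.A 2 1 - T.A 0 1) = 0
  d21 : a₂ * (T.A 1 0 - T.A 0 0) + b₂ * (T.A 1 1 - T.A 0 1) = 0
  d22 : a₂ * (T.A 2 0 - T.A 0 0) + b₂ * (T.A 2 1 - T.A 0 1) = 1

lemma affine_expand {f : V2 → ℝ} (hf : PolyDeg 1 f) :
    ∃ α β γ : ℝ, ∀ x, f x = α + β * x 0 + γ * x 1 := by
  obtain ⟨p, hp, he⟩ := hf
  obtain ⟨c, hc⟩ := mv_expand 1 p hp
  refine ⟨c 0 0, c 1 0, c 0 1, fun x => ?_⟩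
  rw [he, hc]
  simp [Finset.sum_range_succ]
  ring

lemma inv_aux {a b c d u0 u1 v0 v1 : ℝ} (h1 : a * u0 + b * u1 = 1) (h2 : a * v0 + b * v1 = 0)
    (h3 : c * u0 + d * u1 = 0) (h4 : c * v0 + d * v1 = 1) :
    u0 * a + v0 * c = 1 ∧ u0 * b + v0 * d = 0 ∧ u1 * a + v1 * c = 0 ∧ u1 * b + v1 * d = 1 := by
  have hM : (!![a, b; c, d] : Matrix (Fin 2) (Fin 2) ℝ) * !![u0, v0; u1, v1] = 1 := by
    ext i j
    fin_cases i <;> fin_cases j <;> simp [Matrix.mul_apply, Fin.sum_univ_two, *]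
  have hN := mul_eq_one_comm.mp hM
  have e := fun i j => congrFun (congrFun hN i) j
  refine ⟨?_, ?_, ?_, ?_⟩
  · simpa [Matrix.mul_apply, Fin.sum_univ_two] using e 0 0
  · simpa [Matrix.mul_apply, Fin.sum_univ_two] using e 0 1
  · simpa [Matrix.mul_apply, Fin.sum_univ_two] using e 1 0
  · simpa [Matrix.mul_apply, Fin.sum_univ_two] using e 1 1

lemma exists_coord (T : TriangleData) : Nonempty (Coord T) := by
  obtain ⟨α, a, b, h1⟩ := affine_expand (T.lam_poly 1)
  obtain ⟨β, c, d, h2⟩ := affine_expand (T.lam_poly 2)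
  have k10 := T.lam_vertex 1 0
  have k11 := T.lam_vertex 1 1
  have k12 := T.lam_vertex 1 2
  have k20 := T.lam_vertex 2 0
  have k21 := T.lam_vertex 2 1
  have k22 := T.lam_vertex 2 2
  simp [h1] at k10 k11 k12
  simp [h2] at k20 k21 k22
  have d11 : a * (T.A 1 0 - T.A 0 0) + b * (T.A 1 1 - T.A 0 1) = 1 := by linarith
  have d12 : a * (T.A 2 0 - T.A 0 0) + b * (T.A 2 1 - T.A 0 1) = 0 := by linarith
  have d21 : c * (T.A 1 0 - T.A 0 0) + d * (T.A 1 1 - T.A 0 1) = 0 := by linarith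
  have d22 : c * (T.A 2 0 - T.A 0 0) + d * (T.A 2 1 - T.A 0 1) = 1 := by linarith
  obtain ⟨e00, e01, e10, e11⟩ := inv_aux d11 d12 d21 d22
  exact ⟨{ a₁ := a, b₁ := b, a₂ := c, b₂ := d
           lam1 := fun x => by rw [h1]; linarith
           lam2 := fun x => by rw [h2]; linarith
           e00 := e00, e01 := e01, e10 := e10, e11 := e11
           d11 := d11, d12 := d12, d21 := d21, d22 := d22 }⟩

lemma lam0_eq (T : TriangleData) (x : V2) : T.lam 0 x = 1 - T.lam 1 x - T.lam 2 x := by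
  have := T.lam_sum x
  rw [Fin.sum_univ_three] at this
  linarith

/-- the vector with components `f`, `g` in the basis of edge vectors at `A 0` -/
def vec (T : TriangleData) (f g : ℝ) : V2 := f • (T.A 1 - T.A 0) + g • (T.A 2 - T.A 0)

lemma vec_apply (T : TriangleData) (f g : ℝ) (j : Fin 2) :
    vec T f g j = f * (T.A 1 j - T.A 0 j) + g * (T.A 2 j - T.A 0 j) := by
  simp [vec]

lemma V2_ext {x y : V2} (h0 : x 0 = y 0) (h1 : x 1 = y 1) : x = y := by
  ext j; fin_cases j
  · exact h0
  · exact h1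

namespace Coord

variable {T : TriangleData}

/-- first component in the edge basis -/
def c1 (K : Coord T) (w : V2) : ℝ := K.a₁ * w 0 + K.b₁ * w 1

/-- second component in the edge basis -/
def c2 (K : Coord T) (w : V2) : ℝ := K.a₂ * w 0 + K.b₂ * w 1

lemma vec_c (K : Coord T) (w : V2) : vec T (K.c1 w) (K.c2 w) = w := by
  apply V2_ext
  · rw [vec_apply, c1, c2]
    linear_combination w 0 * K.e00 + w 1 * K.e01
  · rw [vec_apply, c1, c2]
    linear_combination w 0 * K.e10 + w 1 * K.e11

lemma c1_vec (K : Coord T) (f g : ℝ) : K.c1 (vec T f g) = f := by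
  rw [c1, vec_apply, vec_apply]
  linear_combination f * K.d11 + g * K.d12

lemma c2_vec (K : Coord T) (f g : ℝ) : K.c2 (vec T f g) = g := by
  rw [c2, vec_apply, vec_apply]
  linear_combination f * K.d21 + g * K.d22

lemma lam1_eq (K : Coord T) (x : V2) : T.lam 1 x = K.c1 (x - T.A 0) := by
  rw [K.lam1, c1]; simp

lemma lam2_eq (K : Coord T) (x : V2) : T.lam 2 x = K.c2 (x - T.A 0) := by
  rw [K.lam2, c2]; simp

lemma lam1_pt (K : Coord T) (s r : ℝ) : T.lam 1 (T.A 0 + vec T s r) = s := by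
  rw [K.lam1_eq, add_sub_cancel_left, K.c1_vec]

lemma lam2_pt (K : Coord T) (s r : ℝ) : T.lam 2 (T.A 0 + vec T s r) = r := by
  rw [K.lam2_eq, add_sub_cancel_left, K.c2_vec]

lemma pt_lam (K : Coord T) (x : V2) : x = T.A 0 + vec T (T.lam 1 x) (T.lam 2 x) := by
  rw [K.lam1_eq, K.lam2_eq, K.vec_c]; simp

/-- Expansion of a polynomial in the affine coordinates. -/
lemma expand (K : Coord T) {k : ℕ} {f : V2 → ℝ} (hf : PolyDeg k f) :
    ∃ c : ℕ → ℕ → ℝ, ∀ x, f x =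
      ∑ i ∈ Finset.range (k + 1), ∑ j ∈ Finset.range (k + 1 - i),
        c i j * (T.lam 1 x ^ i * T.lam 2 x ^ j) := by
  obtain ⟨p, hp, he⟩ := hf
  let l : Fin 2 → MvPolynomial (Fin 2) ℝ := fun i =>
    MvPolynomial.C (T.A 0 i) + (MvPolynomial.C (T.A 1 i - T.A 0 i) * MvPolynomial.X 0 +
      MvPolynomial.C (T.A 2 i - T.A 0 i) * MvPolynomial.X 1)
  have hl : ∀ i, (l i).totalDegree ≤ 1 := by
    intro i
    have hX : ∀ (a : ℝ) (j : Fin 2),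
        (MvPolynomial.C a * MvPolynomial.X j : MvPolynomial (Fin 2) ℝ).totalDegree ≤ 1 := by
      intro a j
      refine (MvPolynomial.totalDegree_mul _ _).trans ?_
      simp
    refine (MvPolynomial.totalDegree_add _ _).trans (max_le (by simp) ?_)
    exact (MvPolynomial.totalDegree_add _ _).trans (max_le (hX _ _) (hX _ _))
  obtain ⟨c, hc⟩ := mv_expand k _ (mv_subst k p hp l hl)
  refine ⟨c, fun x => ?_⟩
  have h := hc ![T.lam 1 x, T.lam 2 x]
  simp only [Matrix.cons_val_zero, Matrix.cons_val_one] at h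
  rw [← h, he]
  have h2 : MvPolynomial.eval ![T.lam 1 x, T.lam 2 x] (MvPolynomial.aeval l p) =
      MvPolynomial.eval (fun i => MvPolynomial.eval ![T.lam 1 x, T.lam 2 x] (l i)) p := by
    rw [MvPolynomial.aeval_eq_bind₁]
    exact MvPolynomial.eval₂Hom_bind₁ _ _ _ _
  rw [h2]
  congr 2
  funext i
  conv_lhs => rw [K.pt_lam x]
  simp [l, vec_apply]
  ring

end Coord

/-- bivariate quadratic with coefficients `c` -/
def qua (c : Fin 6 → ℝ) (s r : ℝ) : ℝ :=
  c 0 + c 1 * s + c 2 * r + c 3 * s ^ 2 + c 4 * (s * r) + c 5 * r ^ 2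

/-- bivariate cubic with coefficients `c` -/
def cub (c : ℕ → ℕ → ℝ) (s r : ℝ) : ℝ :=
  c 0 0 + c 1 0 * s + c 0 1 * r + c 2 0 * s ^ 2 + c 1 1 * (s * r) + c 0 2 * r ^ 2
    + c 3 0 * s ^ 3 + c 2 1 * (s ^ 2 * r) + c 1 2 * (s * r ^ 2) + c 0 3 * r ^ 3

/-- derivative of `cub` in the first variable -/
def cubS (c : ℕ → ℕ → ℝ) (s r : ℝ) : ℝ :=
  c 1 0 + 2 * c 2 0 * s + c 1 1 * r + 3 * c 3 0 * s ^ 2 + 2 * c 2 1 * (s * r) + c 1 2 * r ^ 2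

/-- derivative of `cub` in the second variable -/
def cubR (c : ℕ → ℕ → ℝ) (s r : ℝ) : ℝ :=
  c 0 1 + c 1 1 * s + 2 * c 0 2 * r + c 2 1 * s ^ 2 + 2 * c 1 2 * (s * r) + 3 * c 0 3 * r ^ 2

namespace Coord

variable {T : TriangleData}

lemma expand2 (K : Coord T) {f : V2 → ℝ} (hf : PolyDeg 2 f) :
    ∃ c : Fin 6 → ℝ, ∀ x, f x = qua c (T.lam 1 x) (T.lam 2 x) := by
  obtain ⟨c, hc⟩ := K.expand hf
  refine ⟨![c 0 0, c 1 0, c 0 1, c 2 0, c 1 1, c 0 2], fun x => ?_⟩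
  rw [hc]
  simp [Finset.sum_range_succ, qua]
  ring

lemma expand3 (K : Coord T) {f : V2 → ℝ} (hf : PolyDeg 3 f) :
    ∃ c : ℕ → ℕ → ℝ, ∀ x, f x = cub c (T.lam 1 x) (T.lam 2 x) := by
  obtain ⟨c, hc⟩ := K.expand hf
  refine ⟨c, fun x => ?_⟩
  rw [hc]
  simp [Finset.sum_range_succ, cub]
  ring

lemma vecExpand2 (K : Coord T) {w : V2 → V2} (hw : PolyVecDeg 2 w) :
    ∃ c d : Fin 6 → ℝ, ∀ x, w x = vec T (qua c (T.lam 1 x) (T.lam 2 x))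
      (qua d (T.lam 1 x) (T.lam 2 x)) := by
  obtain ⟨c, hc⟩ := K.expand2 (((hw 0).cmul K.a₁).add ((hw 1).cmul K.b₁))
  obtain ⟨d, hd⟩ := K.expand2 (((hw 0).cmul K.a₂).add ((hw 1).cmul K.b₂))
  exact ⟨c, d, fun x => by rw [← hc, ← hd]; exact (K.vec_c _).symm⟩

lemma vecExpand3 (K : Coord T) {w : V2 → V2} (hw : PolyVecDeg 3 w) :
    ∃ c d : ℕ → ℕ → ℝ, ∀ x, w x = vec T (cub c (T.lam 1 x) (T.lam 2 x))
      (cub d (T.lam 1 x) (T.lam 2 x)) := by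
  obtain ⟨c, hc⟩ := K.expand3 (((hw 0).cmul K.a₁).add ((hw 1).cmul K.b₁))
  obtain ⟨d, hd⟩ := K.expand3 (((hw 0).cmul K.a₂).add ((hw 1).cmul K.b₂))
  exact ⟨c, d, fun x => by rw [← hc, ← hd]; exact (K.vec_c _).symm⟩

lemma poly_vec {k : ℕ} {f g : V2 → ℝ} (hf : PolyDeg k f) (hg : PolyDeg k g) :
    PolyVecDeg k (fun x => vec T (f x) (g x)) := by
  intro j
  refine ((hf.cmul (T.A 1 j - T.A 0 j)).add (hg.cmul (T.A 2 j - T.A 0 j))).congr fun x => ?_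
  rw [vec_apply]; ring

lemma poly_mon (T : TriangleData) {k : ℕ} (a : ℝ) (i j : ℕ) (h : i + j ≤ k) :
    PolyDeg k (fun x => a * (T.lam 1 x ^ i * T.lam 2 x ^ j)) :=
  ((((T.lam_poly 1).pow i).mul ((T.lam_poly 2).pow j)).cmul a).mono h

lemma poly_qua (T : TriangleData) (c : Fin 6 → ℝ) :
    PolyDeg 2 (fun x => qua c (T.lam 1 x) (T.lam 2 x)) := by
  have h := (((((poly_mon T (k := 2) (c 0) 0 0 (by norm_num)).add
    (poly_mon T (c 1) 1 0 (by norm_num))).add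
    (poly_mon T (c 2) 0 1 (by norm_num))).add
    (poly_mon T (c 3) 2 0 (by norm_num))).add
    (poly_mon T (c 4) 1 1 (by norm_num))).add
    (poly_mon T (c 5) 0 2 (by norm_num))
  exact h.congr fun x => by rw [qua]; ring

lemma poly_cub (T : TriangleData) (c : ℕ → ℕ → ℝ) :
    PolyDeg 3 (fun x => cub c (T.lam 1 x) (T.lam 2 x)) := by
  have h := (((((((((poly_mon T (k := 3) (c 0 0) 0 0 (by norm_num)).add
    (poly_mon T (c 1 0) 1 0 (by norm_num))).add
    (poly_mon T (c 0 1) 0 1 (by norm_num))).add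
    (poly_mon T (c 2 0) 2 0 (by norm_num))).add
    (poly_mon T (c 1 1) 1 1 (by norm_num))).add
    (poly_mon T (c 0 2) 0 2 (by norm_num))).add
    (poly_mon T (c 3 0) 3 0 (by norm_num))).add
    (poly_mon T (c 2 1) 2 1 (by norm_num))).add
    (poly_mon T (c 1 2) 1 2 (by norm_num))).add
    (poly_mon T (c 0 3) 0 3 (by norm_num))
  exact h.congr fun x => by rw [cub]; ring

/-- the linear form `c1` as a continuous linear map -/
def l1 (K : Coord T) : V2 →L[ℝ] ℝ :=
  K.a₁ • EuclideanSpace.proj (𝕜 := ℝ) (0 : Fin 2) + K.b₁ • EuclideanSpace.proj (𝕜 := ℝ) (1 : Fin 2)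

/-- the linear form `c2` as a continuous linear map -/
def l2 (K : Coord T) : V2 →L[ℝ] ℝ :=
  K.a₂ • EuclideanSpace.proj (𝕜 := ℝ) (0 : Fin 2) + K.b₂ • EuclideanSpace.proj (𝕜 := ℝ) (1 : Fin 2)

lemma l1_apply (K : Coord T) (w : V2) : K.l1 w = K.c1 w := by simp [l1, c1]

lemma l2_apply (K : Coord T) (w : V2) : K.l2 w = K.c2 w := by simp [l2, c2]

lemma hasD1 (K : Coord T) (x : V2) : HasFDerivAt (T.lam 1) K.l1 x := by
  have h : T.lam 1 = fun x => K.l1 (x - T.A 0) := by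
    funext x; rw [K.l1_apply, K.lam1_eq]
  rw [h]
  exact K.l1.hasFDerivAt.comp x ((hasFDerivAt_id x).sub_const _)

lemma hasD2 (K : Coord T) (x : V2) : HasFDerivAt (T.lam 2) K.l2 x := by
  have h : T.lam 2 = fun x => K.l2 (x - T.A 0) := by
    funext x; rw [K.l2_apply, K.lam2_eq]
  rw [h]
  exact K.l2.hasFDerivAt.comp x ((hasFDerivAt_id x).sub_const _)

lemma hasD_cub (K : Coord T) (c : ℕ → ℕ → ℝ) (x : V2) :
    HasFDerivAt (fun x => cub c (T.lam 1 x) (T.lam 2 x))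
      (cubS c (T.lam 1 x) (T.lam 2 x) • K.l1 + cubR c (T.lam 1 x) (T.lam 2 x) • K.l2) x := by
  have s := K.hasD1 x
  have r := K.hasD2 x
  have h := ((((((((((hasFDerivAt_const (c 0 0) x).add (s.const_mul (c 1 0))).add
    (r.const_mul (c 0 1))).add ((s.pow 2).const_mul (c 2 0))).add
    ((s.mul r).const_mul (c 1 1))).add ((r.pow 2).const_mul (c 0 2))).add
    ((s.pow 3).const_mul (c 3 0))).add (((s.pow 2).mul r).const_mul (c 2 1))).add
    ((s.mul (r.pow 2)).const_mul (c 1 2))).add ((r.pow 3).const_mul (c 0 3)))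
  refine HasFDerivAt.congr_fderiv (h.congr_of_eventuallyEq ?_) ?_
  · exact Filter.Eventually.of_forall fun y => by simp [cub]
  · ext y
    simp [cubS, cubR]
    ring

lemma div_cub (K : Coord T) (c d : ℕ → ℕ → ℝ) (x : V2) :
    divP (fun x => vec T (cub c (T.lam 1 x) (T.lam 2 x)) (cub d (T.lam 1 x) (T.lam 2 x))) x
      = cubS c (T.lam 1 x) (T.lam 2 x) + cubR d (T.lam 1 x) (T.lam 2 x) := by
  have hj : ∀ j, fderiv ℝ (fun y => vec T (cub c (T.lam 1 y) (T.lam 2 y))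
      (cub d (T.lam 1 y) (T.lam 2 y)) j) x = _ := fun j =>
    HasFDerivAt.fderiv ((((K.hasD_cub c x).mul_const (T.A 1 j - T.A 0 j)).add
      ((K.hasD_cub d x).mul_const (T.A 2 j - T.A 0 j))).congr_of_eventuallyEq
      (Filter.Eventually.of_forall fun y => vec_apply T _ _ j))
  rw [divP, Fin.sum_univ_two, hj, hj]
  simp [l1_apply, l2_apply, c1, c2]
  set S := cubS c (T.lam 1 x) (T.lam 2 x)
  set R := cubR d (T.lam 1 x) (T.lam 2 x)
  linear_combination S * K.d11 + R * K.d22 + cubR c (T.lam 1 x) (T.lam 2 x) * K.d21 +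
    cubS d (T.lam 1 x) (T.lam 2 x) * K.d12

end Coord

/-! ### Edges -/

namespace Edge

variable (T : TriangleData)

lemma Ept0 (t : ℝ) : T.Ept 0 t = T.A 0 + vec T (1 - t) t := by
  change T.A 1 + t • (T.A 2 - T.A 1) = _
  rw [vec]; module

lemma Ept1 (t : ℝ) : T.Ept 1 t = T.A 0 + vec T 0 (1 - t) := by
  change T.A 2 + t • (T.A 0 - T.A 2) = _
  rw [vec]; module

lemma Ept2 (t : ℝ) : T.Ept 2 t = T.A 0 + vec T t 0 := by
  change T.A 0 + t • (T.A 1 - T.A 0) = _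
  rw [vec]; module

lemma A0 : T.A 0 = T.A 0 + vec T 0 0 := by rw [vec]; module

lemma A1 : T.A 1 = T.A 0 + vec T 1 0 := by rw [vec]; module

lemma A2 : T.A 2 = T.A 0 + vec T 0 1 := by rw [vec]; module

lemma mid_eq (i : Fin 3) : T.mid i = T.Ept i (1 / 2) := by
  rw [TriangleData.mid, TriangleData.Ept, midpoint_eq_smul_add]
  rw [invOf_eq_inv]; module

lemma dot_vec (f g : ℝ) (n : V2) :
    dot (vec T f g) n = f * dot n (T.A 1 - T.A 0) + g * dot n (T.A 2 - T.A 0) := by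
  simp [dot, vec_apply, Fin.sum_univ_two]; ring

lemma dot_sub' (n x y : V2) : dot n (x - y) = dot n x - dot n y := by
  simp [dot, Fin.sum_univ_two]; ring

lemma dot_n0 : ∃ m : ℝ, m ≠ 0 ∧ ∀ f g, dot (vec T f g) (T.nv 0) = (f + g) * m := by
  have h1 : dot (T.nv 0) (T.A 2 - T.A 1) = 0 := T.nv_orth 0
  have h2 : dot (T.nv 0) (T.A 0 - T.A 1) < 0 := T.nv_outward 0
  rw [dot_sub'] at h1 h2
  refine ⟨dot (T.nv 0) (T.A 1 - T.A 0), ?_, fun f g => ?_⟩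
  · rw [dot_sub']; intro h; linarith
  · rw [dot_vec, dot_sub', dot_sub']
    linear_combination g * h1

lemma dot_n1 : ∃ m : ℝ, m ≠ 0 ∧ ∀ f g, dot (vec T f g) (T.nv 1) = f * m := by
  have h1 : dot (T.nv 1) (T.A 0 - T.A 2) = 0 := T.nv_orth 1
  have h2 : dot (T.nv 1) (T.A 1 - T.A 2) < 0 := T.nv_outward 1
  rw [dot_sub'] at h1 h2
  refine ⟨dot (T.nv 1) (T.A 1 - T.A 0), ?_, fun f g => ?_⟩
  · rw [dot_sub']; intro h; linarith
  · rw [dot_vec, dot_sub', dot_sub']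
    linear_combination (-g) * h1

lemma dot_n2 : ∃ m : ℝ, m ≠ 0 ∧ ∀ f g, dot (vec T f g) (T.nv 2) = g * m := by
  have h1 : dot (T.nv 2) (T.A 1 - T.A 0) = 0 := T.nv_orth 2
  have h2 : dot (T.nv 2) (T.A 2 - T.A 0) < 0 := T.nv_outward 2
  rw [dot_sub'] at h1 h2
  refine ⟨dot (T.nv 2) (T.A 2 - T.A 0), ?_, fun f g => ?_⟩
  · rw [dot_sub']; intro h; linarith
  · rw [dot_vec, dot_sub', dot_sub']
    linear_combination f * h1

end Edge

/-! ### Parametrization of `P₃*` -/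

/-- coefficients of the first component of an element of `P₃*` -/
def fc (c : Fin 9 → ℝ) : ℕ → ℕ → ℝ
  | 0, 0 => c 0
  | 1, 0 => c 1
  | 0, 1 => c 2
  | 2, 0 => c 6 / 2 - c 7 + c 8 / 3
  | 1, 1 => c 6
  | 3, 0 => c 7
  | 2, 1 => 2 * c 7 + 2 / 3 * c 8
  | 1, 2 => c 8
  | _, _ => 0

/-- coefficients of the second component of an element of `P₃*` -/
def gc (c : Fin 9 → ℝ) : ℕ → ℕ → ℝ
  | 0, 0 => c 3
  | 1, 0 => c 4
  | 0, 1 => c 5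
  | 1, 1 => -2 * (c 6 / 2 - c 7 + c 8 / 3)
  | 0, 2 => - c 6 / 2
  | 2, 1 => -3 * c 7
  | 1, 2 => -(2 * c 7 + 2 / 3 * c 8)
  | 0, 3 => - c 8 / 3
  | _, _ => 0

/-- the element of `P₃*` with parameters `c` -/
def pst (T : TriangleData) (c : Fin 9 → ℝ) (x : V2) : V2 :=
  vec T (cub (fc c) (T.lam 1 x) (T.lam 2 x)) (cub (gc c) (T.lam 1 x) (T.lam 2 x))

lemma pst_mem {T : TriangleData} (K : Coord T) (c : Fin 9 → ℝ) : T.memP3star (pst T c) := by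
  refine ⟨Coord.poly_vec (Coord.poly_cub T _) (Coord.poly_cub T _), ⟨c 1 + c 5, fun x => ?_⟩, ?_⟩
  · refine (K.div_cub _ _ x).trans ?_
    simp only [cubS, cubR, fc, gc]; ring
  · intro i
    fin_cases i
    · obtain ⟨m, -, hm⟩ := Edge.dot_n0 T
      refine ⟨m * (cub (fc c) 0 1 + cub (gc c) 0 1 - (cub (fc c) 1 0 + cub (gc c) 1 0)),
        m * (cub (fc c) 1 0 + cub (gc c) 1 0), fun t => ?_⟩
      simp only [Fin.zero_eta, pst]
      rw [hm, Edge.Ept0, K.lam1_pt, K.lam2_pt]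
      simp only [cub, fc, gc]; ring
    · obtain ⟨m, -, hm⟩ := Edge.dot_n1 T
      refine ⟨m * (cub (fc c) 0 0 - cub (fc c) 0 1), m * cub (fc c) 0 1, fun t => ?_⟩
      simp only [Fin.mk_one, pst]
      rw [hm, Edge.Ept1, K.lam1_pt, K.lam2_pt]
      simp only [cub, fc]; ring
    · obtain ⟨m, -, hm⟩ := Edge.dot_n2 T
      refine ⟨m * (cub (gc c) 1 0 - cub (gc c) 0 0), m * cub (gc c) 0 0, fun t => ?_⟩
      simp only [Fin.reduceFinMk, pst]
      rw [hm, Edge.Ept2, K.lam1_pt, K.lam2_pt]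
      simp only [cub, gc]; ring

lemma cubic_affine {a0 a1 a2 a3 m a c : ℝ} (hm : m ≠ 0)
    (h : ∀ t : ℝ, (a0 + a1 * t + a2 * t ^ 2 + a3 * t ^ 3) * m = a * t + c) :
    a2 = 0 ∧ a3 = 0 := by
  have h0 := h 0
  have h1 := h 1
  have h2 := h (-1)
  have h3 := h 2
  constructor
  · refine (mul_eq_zero.mp (?_ : a2 * m = 0)).resolve_right hm
    linarith
  · refine (mul_eq_zero.mp (?_ : a3 * m = 0)).resolve_right hm
    linarith

lemma mem_pst {T : TriangleData} (K : Coord T) {p : V2 → V2} (hp : T.memP3star p) :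
    ∃ c, p = pst T c := by
  obtain ⟨h3, ⟨k, hk⟩, he⟩ := hp
  obtain ⟨f, g, hfg⟩ := K.vecExpand3 h3
  obtain rfl : p = fun x => vec T (cub f (T.lam 1 x) (T.lam 2 x)) (cub g (T.lam 1 x) (T.lam 2 x)) :=
    funext hfg
  have hd : ∀ s r, cubS f s r + cubR g s r = k := fun s r => by
    have := hk (T.A 0 + vec T s r)
    rwa [K.div_cub, K.lam1_pt, K.lam2_pt] at this
  have d1 := hd 0 0
  have d2 := hd 1 0
  have d3 := hd (-1) 0
  have d4 := hd 0 1
  have d5 := hd 0 (-1)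
  have d6 := hd 1 1
  simp only [cubS, cubR] at d1 d2 d3 d4 d5 d6
  ring_nf at d1 d2 d3 d4 d5 d6
  obtain ⟨m0, hm0, h0⟩ := Edge.dot_n0 T
  obtain ⟨m1, hm1, h1⟩ := Edge.dot_n1 T
  obtain ⟨m2, hm2, h2⟩ := Edge.dot_n2 T
  obtain ⟨x0, y0, e0⟩ := he 0
  obtain ⟨x1, y1, e1⟩ := he 1
  obtain ⟨x2, y2, e2⟩ := he 2
  simp only [h0, h1, h2, Edge.Ept0, Edge.Ept1, Edge.Ept2, K.lam1_pt, K.lam2_pt] at e0 e1 e2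
  obtain ⟨q1, q2⟩ := cubic_affine (a0 := g 0 0) (a1 := g 1 0) (a2 := g 2 0) (a3 := g 3 0) hm2
    fun t => by rw [← e2 t]; simp only [cub]; ring
  obtain ⟨q3, q4⟩ := cubic_affine (a0 := f 0 0) (a1 := f 0 1) (a2 := f 0 2) (a3 := f 0 3)
    (a := - x1) (c := x1 + y1) hm1
    fun t => by
      have := e1 (1 - t)
      simp only [cub] at this ⊢
      linear_combination this
  obtain ⟨q5, q6⟩ := cubic_affine (a0 := f 0 0 + g 0 0 + (f 0 1 + g 0 1) + (f 0 2 + g 0 2)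
      + (f 0 3 + g 0 3))
    (a1 := (f 1 0 + g 1 0) - (f 0 1 + g 0 1) + (f 1 1 + g 1 1) - 2 * (f 0 2 + g 0 2)
      + (f 1 2 + g 1 2) - 3 * (f 0 3 + g 0 3))
    (a2 := (f 2 0 + g 2 0) - (f 1 1 + g 1 1) + (f 0 2 + g 0 2) + (f 2 1 + g 2 1)
      - 2 * (f 1 2 + g 1 2) + 3 * (f 0 3 + g 0 3))
    (a3 := (f 3 0 + g 3 0) - (f 2 1 + g 2 1) + (f 1 2 + g 1 2) - (f 0 3 + g 0 3))
    (a := - x0) (c := x0 + y0) hm0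
    fun t => by
      have := e0 (1 - t)
      simp only [cub] at this ⊢
      linear_combination this
  refine ⟨![f 0 0, f 1 0, f 0 1, g 0 0, g 1 0, g 0 1, f 1 1, f 3 0, f 1 2], funext fun x => ?_⟩
  have r1 : g 1 1 = -2 * f 2 0 := by linarith
  have r2 : g 0 2 = - f 1 1 / 2 := by linarith
  have r3 : g 2 1 = -3 * f 3 0 := by linarith
  have r4 : g 0 3 = - f 1 2 / 3 := by linarith
  have r5 : g 1 2 = - f 2 1 := by linarith
  have r6 : f 2 1 = 2 * f 3 0 + 2 / 3 * f 1 2 := by linarith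
  have r7 : f 2 0 = f 1 1 / 2 - f 3 0 + f 1 2 / 3 := by linarith
  simp only [pst]
  congr 1
  · simp [cub, fc, q3, q4, r6, r7]
  · simp [cub, gc, q1, q2, r1, r2, r3, r4, r5, r6, r7]

/-! ### The bubble and the normal derivatives -/

/-- coefficients of the bubble -/
def bc : ℕ → ℕ → ℝ
  | 1, 1 => 1
  | 2, 1 => -1
  | 1, 2 => -1
  | _, _ => 0

lemma bub_eq (T : TriangleData) (x : V2) : T.bub x = cub bc (T.lam 1 x) (T.lam 2 x) := by
  rw [TriangleData.bub, Fin.prod_univ_three, lam0_eq]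
  simp only [cub, bc]; ring

lemma fderiv_bub_mul {T : TriangleData} (K : Coord T) (c : Fin 9 → ℝ) (n d y : V2)
    (hy : T.bub y = 0) :
    fderiv ℝ (fun x => dot (T.bub x • pst T c x) n) y d =
      (cubS bc (T.lam 1 y) (T.lam 2 y) * K.c1 d + cubR bc (T.lam 1 y) (T.lam 2 y) * K.c2 d)
        * dot (pst T c y) n := by
  have hb := K.hasD_cub bc y
  have hp := ((K.hasD_cub (fc c) y).mul_const (dot n (T.A 1 - T.A 0))).add
    ((K.hasD_cub (gc c) y).mul_const (dot n (T.A 2 - T.A 0)))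
  have h := (hb.mul hp).congr_of_eventuallyEq (f₁ := fun x => dot (T.bub x • pst T c x) n)
    (Filter.Eventually.of_forall fun x => by
      have : dot (T.bub x • pst T c x) n = T.bub x * dot (pst T c x) n := by
        simp [dot, Fin.sum_univ_two]; ring
      refine this.trans ?_
      simp only [bub_eq, pst, Edge.dot_vec, Pi.mul_apply, Pi.add_apply])
  rw [h.fderiv]
  rw [bub_eq] at hy
  simp [hy, Coord.l1_apply, Coord.l2_apply, pst, Edge.dot_vec]
  ring

lemma dot_nv_self (T : TriangleData) (i : Fin 3) : dot (T.nv i) (T.nv i) = 1 := by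
  have h := T.nv_unit i
  rw [EuclideanSpace.norm_eq, Real.sqrt_eq_one, Fin.sum_univ_two] at h
  rw [dot, Fin.sum_univ_two, ← h]
  simp [sq]

lemma bub_Ept {T : TriangleData} (K : Coord T) (i : Fin 3) (t : ℝ) : T.bub (T.Ept i t) = 0 := by
  fin_cases i
  · simp only [Fin.zero_eta]
    rw [bub_eq, Edge.Ept0, K.lam1_pt, K.lam2_pt]; simp only [cub, bc]; ring
  · simp only [Fin.mk_one]
    rw [bub_eq, Edge.Ept1, K.lam1_pt, K.lam2_pt]; simp only [cub, bc]; ring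
  · simp only [Fin.reduceFinMk]
    rw [bub_eq, Edge.Ept2, K.lam1_pt, K.lam2_pt]; simp only [cub, bc]; ring

lemma nder_eq {T : TriangleData} (K : Coord T) (i : Fin 3) : ∃ κ : ℝ, κ ≠ 0 ∧
    ∀ (c : Fin 9 → ℝ) (n : V2) (t : ℝ), T.nder (fun x => dot (T.bub x • pst T c x) n) i t =
      κ * (t * (1 - t)) * dot (pst T c (T.Ept i t)) n := by
  have hu := dot_nv_self T i
  have hv := K.vec_c (T.nv i)
  fin_cases i
  · simp only [Fin.zero_eta] at hu hv ⊢
    obtain ⟨m, -, hm⟩ := Edge.dot_n0 T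
    refine ⟨-(K.c1 (T.nv 0) + K.c2 (T.nv 0)), ?_, fun c n t => ?_⟩
    · intro h0
      have := hm (K.c1 (T.nv 0)) (K.c2 (T.nv 0))
      rw [hv, hu, neg_eq_zero.mp h0] at this
      simp at this
    · rw [TriangleData.nder, fderiv_bub_mul K _ _ _ _ (bub_Ept K 0 t), Edge.Ept0, K.lam1_pt,
        K.lam2_pt]
      simp only [cubS, cubR, bc]; ring
  · simp only [Fin.mk_one] at hu hv ⊢
    obtain ⟨m, -, hm⟩ := Edge.dot_n1 T
    refine ⟨K.c1 (T.nv 1), ?_, fun c n t => ?_⟩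
    · intro h0
      have := hm (K.c1 (T.nv 1)) (K.c2 (T.nv 1))
      rw [hv, hu, h0] at this
      simp at this
    · rw [TriangleData.nder, fderiv_bub_mul K _ _ _ _ (bub_Ept K 1 t), Edge.Ept1, K.lam1_pt,
        K.lam2_pt]
      simp only [cubS, cubR, bc]; ring
  · simp only [Fin.reduceFinMk] at hu hv ⊢
    obtain ⟨m, -, hm⟩ := Edge.dot_n2 T
    refine ⟨K.c2 (T.nv 2), ?_, fun c n t => ?_⟩
    · intro h0
      have := hm (K.c1 (T.nv 2)) (K.c2 (T.nv 2))
      rw [hv, hu, h0] at this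
      simp at this
    · rw [TriangleData.nder, fderiv_bub_mul K _ _ _ _ (bub_Ept K 2 t), Edge.Ept2, K.lam1_pt,
        K.lam2_pt]
      simp only [cubS, cubR, bc]; ring

/-! ### Moments -/

lemma integral_poly5 (a0 a1 a2 a3 a4 a5 : ℝ) :
    ∫ t in (0 : ℝ)..1, (a0 + a1 * t + a2 * t ^ 2 + a3 * t ^ 3 + a4 * t ^ 4 + a5 * t ^ 5) =
      a0 + a1 / 2 + a2 / 3 + a3 / 4 + a4 / 5 + a5 / 6 := by
  have hd : ∀ t ∈ Set.uIcc (0 : ℝ) 1, HasDerivAt (fun t : ℝ => a0 * t + a1 / 2 * t ^ 2 +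
      a2 / 3 * t ^ 3 + a3 / 4 * t ^ 4 + a4 / 5 * t ^ 5 + a5 / 6 * t ^ 6)
      (a0 + a1 * t + a2 * t ^ 2 + a3 * t ^ 3 + a4 * t ^ 4 + a5 * t ^ 5) t := by
    intro t _
    have h := ((((((hasDerivAt_id t).const_mul a0).add ((hasDerivAt_pow 2 t).const_mul (a1 / 2))).add
      ((hasDerivAt_pow 3 t).const_mul (a2 / 3))).add
      ((hasDerivAt_pow 4 t).const_mul (a3 / 4))).add
      ((hasDerivAt_pow 5 t).const_mul (a4 / 5))).add
      ((hasDerivAt_pow 6 t).const_mul (a5 / 6))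
    refine HasDerivAt.congr_deriv h ?_
    push_cast
    ring
  rw [intervalIntegral.integral_eq_sub_of_hasDerivAt hd]
  · ring
  · exact Continuous.intervalIntegrable (by fun_prop) _ _

lemma moment_cubic {a0 a1 a2 a3 κ : ℝ} (hκ : κ ≠ 0) {N : ℝ → ℝ}
    (hN : ∀ t, N t = κ * (t * (1 - t)) * (a0 + a1 * t + a2 * t ^ 2 + a3 * t ^ 3))
    (h : ∫ t in (0 : ℝ)..1, N t = 0) :
    a0 / 6 + a1 / 12 + a2 / 20 + a3 / 30 = 0 := by
  have : N = fun t => 0 + κ * a0 * t + κ * (a1 - a0) * t ^ 2 + κ * (a2 - a1) * t ^ 3 +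
      κ * (a3 - a2) * t ^ 4 + κ * (-a3) * t ^ 5 := by
    funext t; rw [hN]; ring
  rw [this, integral_poly5] at h
  refine (mul_eq_zero.mp (?_ : κ * _ = 0)).resolve_left hκ
  linear_combination h

lemma moment_lin {a b m κ : ℝ} (hκ : κ ≠ 0) (hm : m ≠ 0) {N : ℝ → ℝ}
    (hN : ∀ t, N t = κ * (t * (1 - t)) * ((a * t + b) * m))
    (h : ∀ k : Fin 2, ∫ t in (0 : ℝ)..1, N t * t ^ (k : ℕ) = 0) :
    a = 0 ∧ b = 0 := by
  have h0 := moment_cubic (a0 := b) (a1 := a) (a2 := 0) (a3 := 0) (mul_ne_zero hκ hm)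
    (fun t => by rw [hN]; simp; ring) (h 0)
  have h1 := moment_cubic (a0 := 0) (a1 := b) (a2 := a) (a3 := 0) (mul_ne_zero hκ hm)
    (fun t => by rw [hN]; simp; ring) (h 1)
  constructor <;> linarith

lemma dot_smul_tv (T : TriangleData) (i : Fin 3) : ∃ m : ℝ, m ≠ 0 ∧
    ∀ a : ℝ, dot (a • (T.A (i + 2) - T.A (i + 1))) (T.tv i) = a * m := by
  have hne : T.A (i + 2) - T.A (i + 1) ≠ 0 := by
    rw [sub_ne_zero]
    intro h
    have := T.indep.injective h
    fin_cases i <;> simp at this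
  have hn : ‖T.A (i + 2) - T.A (i + 1)‖ ≠ 0 := norm_ne_zero_iff.mpr hne
  refine ⟨‖T.A (i + 2) - T.A (i + 1)‖, hn, fun a => ?_⟩
  rw [TriangleData.tv]
  generalize T.A (i + 2) - T.A (i + 1) = e at *
  have h2 : ‖e‖ ^ 2 = e 0 * e 0 + e 1 * e 1 := by
    rw [EuclideanSpace.norm_sq_eq, Fin.sum_univ_two]; simp [sq]
  have : dot (a • e) (‖e‖⁻¹ • e) = a * ‖e‖⁻¹ * ‖e‖ ^ 2 := by
    rw [h2]; simp [dot, Fin.sum_univ_two]; ring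
  rw [this]; field_simp

/-! ### Unisolvence -/

lemma pst_unisolvent {T : TriangleData} (K : Coord T) (c : Fin 9 → ℝ)
    (ht : ∀ i, (∫ t in (0 : ℝ)..1,
      T.nder (fun x => dot (T.bub x • pst T c x) (T.tv i)) i t) = 0)
    (hn : ∀ i, ∀ k : Fin 2, (∫ t in (0 : ℝ)..1,
      T.nder (fun x => dot (T.bub x • pst T c x) (T.nv i)) i t * t ^ (k : ℕ)) = 0) :
    c = 0 := by
  obtain ⟨κ0, hκ0, n0⟩ := nder_eq K 0
  obtain ⟨κ1, hκ1, n1⟩ := nder_eq K 1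
  obtain ⟨κ2, hκ2, n2⟩ := nder_eq K 2
  obtain ⟨m0, hm0, h0⟩ := Edge.dot_n0 T
  obtain ⟨m1, hm1, h1⟩ := Edge.dot_n1 T
  obtain ⟨m2, hm2, h2⟩ := Edge.dot_n2 T
  obtain ⟨τ0, hτ0, t0⟩ := dot_smul_tv T 0
  obtain ⟨τ1, hτ1, t1⟩ := dot_smul_tv T 1
  obtain ⟨τ2, hτ2, t2⟩ := dot_smul_tv T 2
  -- normal components
  obtain ⟨p1, p2⟩ := moment_lin (a := c 4) (b := c 3) hκ2 hm2 (fun t => by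
    rw [n2, pst, h2, Edge.Ept2, K.lam1_pt, K.lam2_pt]; simp only [cub, gc]; ring) (hn 2)
  obtain ⟨p3, p4⟩ := moment_lin (a := - c 2) (b := c 2 + c 0) hκ1 hm1 (fun t => by
    rw [n1, pst, h1, Edge.Ept1, K.lam1_pt, K.lam2_pt]; simp only [cub, fc]; ring) (hn 1)
  obtain ⟨p5, p6⟩ := moment_lin
    (a := cub (fc c) 0 1 + cub (gc c) 0 1 - (cub (fc c) 1 0 + cub (gc c) 1 0))
    (b := cub (fc c) 1 0 + cub (gc c) 1 0) hκ0 hm0 (fun t => by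
    rw [n0, pst, h0, Edge.Ept0, K.lam1_pt, K.lam2_pt]; simp only [cub, fc, gc]; ring) (hn 0)
  have p3' : c 2 = 0 := by linarith
  have p4' : c 0 = 0 := by linarith
  simp only [cub, fc, gc] at p5 p6
  -- tangential components
  have q2 := moment_cubic (a0 := c 0) (a1 := c 1) (a2 := c 6 / 2 - c 7 + c 8 / 3) (a3 := c 7)
    (mul_ne_zero hκ2 hτ2) (fun t => by
      have e : pst T c (T.Ept 2 t) = cub (fc c) t 0 • (T.A (2 + 2) - T.A (2 + 1)) := by
        have e0 : cub (gc c) t 0 = 0 := by simp [cub, gc, p1, p2]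
        rw [pst, Edge.Ept2, K.lam1_pt, K.lam2_pt, e0, vec, zero_smul, add_zero]
        rfl
      rw [n2, e, t2]; simp only [cub, fc]; ring) (ht 2)
  have q1 := moment_cubic (a0 := c 3 + c 5 - c 6 / 2 - c 8 / 3) (a1 := - c 5 + c 6 + c 8)
    (a2 := - c 6 / 2 - c 8) (a3 := c 8 / 3)
    (mul_ne_zero hκ1 (neg_ne_zero.mpr hτ1)) (fun t => by
      have e : pst T c (T.Ept 1 t) = (- cub (gc c) 0 (1 - t)) • (T.A (1 + 2) - T.A (1 + 1)) := by
        have e0 : cub (fc c) 0 (1 - t) = 0 := by simp [cub, fc, p3', p4']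
        rw [pst, Edge.Ept1, K.lam1_pt, K.lam2_pt, e0, vec, zero_smul, zero_add]
        change _ = (- cub (gc c) 0 (1 - t)) • (T.A 0 - T.A 2)
        module
      rw [n1, e, t1]; simp only [cub, gc]; ring) (ht 1)
  have q0 := moment_cubic (a0 := c 3 + c 4)
    (a1 := - c 4 + c 5 + gc c 1 1 + gc c 2 1)
    (a2 := gc c 0 2 - gc c 1 1 - 2 * gc c 2 1 + gc c 1 2)
    (a3 := gc c 2 1 - gc c 1 2 + gc c 0 3)
    (mul_ne_zero hκ0 hτ0) (fun t => by
      have e : pst T c (T.Ept 0 t) = cub (gc c) (1 - t) t • (T.A (0 + 2) - T.A (0 + 1)) := by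
        have e0 : cub (fc c) (1 - t) t = - cub (gc c) (1 - t) t := by
          simp only [cub, fc, gc]
          linear_combination t * p5 + p6
        rw [pst, Edge.Ept0, K.lam1_pt, K.lam2_pt, e0, vec]
        change _ = cub (gc c) (1 - t) t • (T.A 2 - T.A 1)
        module
      rw [n0, e, t0]; simp only [cub, gc]; ring) (ht 0)
  simp only [gc] at q0
  have z1 : c 8 = 0 := by linarith
  have z2 : c 7 = 0 := by linarith
  have z3 : c 6 = 0 := by linarith
  have z4 : c 1 = 0 := by linarith
  have z5 : c 5 = 0 := by linarith
  funext i
  fin_cases i <;> simp [*]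

/-- the parametrization of `W(T)` -/
def Phi (T : TriangleData) :
    ((Fin 6 → ℝ) × (Fin 6 → ℝ) × (Fin 9 → ℝ)) →ₗ[ℝ] (V2 → V2) where
  toFun e x := vec T (qua e.1 (T.lam 1 x) (T.lam 2 x)) (qua e.2.1 (T.lam 1 x) (T.lam 2 x)) +
    T.bub x • pst T e.2.2 x
  map_add' e e' := by
    funext x
    apply V2_ext <;>
    · simp [vec_apply, pst, qua, cub, fc, gc]
      ring
  map_smul' a e := by
    funext x
    apply V2_ext <;>
    · simp [vec_apply, pst, qua, cub, fc, gc]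
      ring

lemma Phi_apply (T : TriangleData) (e) (x : V2) : Phi T e x =
    vec T (qua e.1 (T.lam 1 x) (T.lam 2 x)) (qua e.2.1 (T.lam 1 x) (T.lam 2 x)) +
    T.bub x • pst T e.2.2 x := rfl

lemma memW2_iff {T : TriangleData} (K : Coord T) (w : V2 → V2) :
    T.memW2 w ↔ ∃ e, Phi T e = w := by
  constructor
  · rintro ⟨q, p, hq, hp, h⟩
    obtain ⟨a, b, hab⟩ := K.vecExpand2 hq
    obtain ⟨c, rfl⟩ := mem_pst K hp
    exact ⟨(a, b, c), funext fun x => by rw [h, hab]; rfl⟩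
  · rintro ⟨e, rfl⟩
    exact ⟨_, _, Coord.poly_vec (Coord.poly_qua T e.1) (Coord.poly_qua T e.2.1),
      pst_mem K e.2.2, fun x => rfl⟩

lemma qua_zero {a : Fin 6 → ℝ} (h1 : qua a 0 0 = 0) (h2 : qua a 1 0 = 0) (h3 : qua a 0 1 = 0)
    (h4 : qua a (1 / 2) (1 / 2) = 0) (h5 : qua a 0 (1 / 2) = 0) (h6 : qua a (1 / 2) 0 = 0) :
    a = 0 := by
  simp only [qua] at h1 h2 h3 h4 h5 h6
  have z0 : a 0 = 0 := by linarith
  have z1 : a 1 = 0 := by linarith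
  have z2 : a 2 = 0 := by linarith
  have z3 : a 3 = 0 := by linarith
  have z4 : a 4 = 0 := by linarith
  have z5 : a 5 = 0 := by linarith
  funext i
  fin_cases i <;> simp [*]

lemma Phi_unisolvent {T : TriangleData} (K : Coord T) (e) (h : T.dofsVanish (Phi T e)) :
    e = 0 := by
  obtain ⟨hv, hm, ht, hn⟩ := h
  obtain ⟨a, b, c⟩ := e
  have key : ∀ s r, Phi T (a, b, c) (T.A 0 + vec T s r) = 0 → T.bub (T.A 0 + vec T s r) = 0 →
      qua a s r = 0 ∧ qua b s r = 0 := by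
    intro s r h hb
    rw [Phi_apply, hb, zero_smul, add_zero, K.lam1_pt, K.lam2_pt] at h
    have h1 := K.c1_vec (qua a s r) (qua b s r)
    have h2 := K.c2_vec (qua a s r) (qua b s r)
    simp only at h
    rw [h] at h1 h2
    simp [Coord.c1, Coord.c2] at h1 h2
    exact ⟨h1.symm, h2.symm⟩
  have hB : ∀ s r, cub bc s r = 0 → T.bub (T.A 0 + vec T s r) = 0 := by
    intro s r h
    rw [bub_eq, K.lam1_pt, K.lam2_pt, h]
  have k1 := key 0 0 (by rw [← Edge.A0]; exact hv 0) (hB _ _ (by simp only [cub, bc]; norm_num))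
  have k2 := key 1 0 (by rw [← Edge.A1]; exact hv 1) (hB _ _ (by simp only [cub, bc]; norm_num))
  have k3 := key 0 1 (by rw [← Edge.A2]; exact hv 2) (hB _ _ (by simp only [cub, bc]; norm_num))
  have k4 := key (1 / 2) (1 / 2) (by
    have := hm 0
    rw [Edge.mid_eq, Edge.Ept0] at this
    convert this using 4; norm_num) (hB _ _ (by simp only [cub, bc]; norm_num))
  have k5 := key 0 (1 / 2) (by
    have := hm 1
    rw [Edge.mid_eq, Edge.Ept1] at this
    convert this using 4; norm_num) (hB _ _ (by simp only [cub, bc]; norm_num))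
  have k6 := key (1 / 2) 0 (by
    have := hm 2
    rwa [Edge.mid_eq, Edge.Ept2] at this) (hB _ _ (by simp only [cub, bc]; norm_num))
  obtain rfl := qua_zero k1.1 k2.1 k3.1 k4.1 k5.1 k6.1
  obtain rfl := qua_zero k1.2 k2.2 k3.2 k4.2 k5.2 k6.2
  have hP : Phi T (0, 0, c) = fun x => T.bub x • pst T c x := by
    funext x
    rw [Phi_apply]
    simp [qua, vec]
  rw [hP] at ht hn
  obtain rfl := pst_unisolvent K c ht hn
  rfl

/-- Unisolvency of the second element: `W(T) = [P₂(T)]² ⊕ b·P₃*(T)`, where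
`P₃*(T) = {w ∈ [P₃(T)]² : ∇·w ∈ P₀(T), (w·n)|_e ∈ P₁(e)}`, has dimension `21`, and any
`w ∈ W(T)` is uniquely determined by the 21 degrees of freedom (vertex and midpoint
values, edge moments of normal derivatives): if they all vanish then `w = 0`. -/
theorem stmt12 (T : TriangleData) :
    Module.finrank ℝ (Submodule.span ℝ {w : V2 → V2 | T.memW2 w}) = 21 ∧
      ∀ w : V2 → V2, T.memW2 w → T.dofsVanish w → w = 0 := by
  obtain ⟨K⟩ := exists_coord T
  have hset : {w : V2 → V2 | T.memW2 w} = (LinearMap.range (Phi T) : Set (V2 → V2)) := by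
    ext w
    exact memW2_iff K w
  have hinj : Function.Injective (Phi T) := by
    rw [← LinearMap.ker_eq_bot, LinearMap.ker_eq_bot']
    intro e he
    apply Phi_unisolvent K
    rw [he]
    refine ⟨fun _ => rfl, fun _ => rfl, fun i => ?_, fun i k => ?_⟩ <;>
      simp [TriangleData.nder, dot]
  constructor
  · rw [hset, Submodule.span_eq, LinearMap.finrank_range_of_inj hinj]
    simp
  · intro w hw hd
    obtain ⟨e, rfl⟩ := (memW2_iff K w).mp hw
    rw [Phi_unisolvent K e hd, map_zero]
end
end
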